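/- Let R be a finite connected simple graph with r = |V(R)| ≥ 2 vertices and s = |E(R)| ≥ 1 edges. Let m, n ≥ 1 be integers, let x, c be positive reals with x ≤ n, let y ∈ (0,1], and let h be a function assigning to each nonempty subset E of E(R) a nonnegative real number such that h(E) ≤ r! · c · (x/n)^{‖E‖} · y^{|E|}. Then Σ_{(φ,ψ): φ ≠ ψ} Π_{k ∈ Ran(φ) ∪ Ran(ψ)} h(φ^{−1}(k) ∪ ψ^{−1}(k)) ≤ (e^{r! c x m / n} − 1) · (2s)^{2s} · x^r · y^{s+1} · n^{−r}, where the sum ranges over all ordered pairs of distinct functions φ, ψ: E(R) → {1, …, m}, Ran(φ) denotes the range of φ, and φ^{−1}(k) denotes the preimage of {k} under φ. -/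

import Mathlib

open Finset Real

/-- `‖E‖`: the number of vertices incident to at least one edge of `E`. -/
def nodeCount {V : Type*} [Fintype V] [DecidableEq V] (E : Finset (Sym2 V)) : ℕ :=
  (Finset.univ.filter (fun v => ∃ e ∈ E, v ∈ e)).card

/-- Incidence counting for a connected cover with two members overlapping in two points. -/
lemma cover_node_count {V κ : Type*} [Fintype V] [DecidableEq V] [DecidableEq κ]
    (N : κ → Finset V) (K : Finset κ)
    (hcross : ∀ U : Finset V, U.Nonempty → U ≠ univ → ∃ k ∈ K, (N k ∩ U).Nonempty ∧ ¬ N k ⊆ U)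
    (hne : ∀ k ∈ K, (N k).Nonempty) (k₁ k₂ : κ) (h1 : k₁ ∈ K) (h2 : k₂ ∈ K) (h12 : k₁ ≠ k₂)
    (hov : 2 ≤ (N k₁ ∩ N k₂).card) :
    Fintype.card V + K.card ≤ ∑ k ∈ K, (N k).card := by
  have key : ∀ t, t + 2 ≤ K.card → ∃ S ⊆ K, S.card = t + 2 ∧ k₁ ∈ S ∧
      (S.biUnion N).card + S.card ≤ ∑ k ∈ S, (N k).card := by
    intro t
    induction t with
    | zero =>
      intro _
      refine ⟨{k₁, k₂}, ?_, card_pair h12, by simp, ?_⟩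
      · intro k hk
        simp only [mem_insert, mem_singleton] at hk
        rcases hk with rfl | rfl <;> assumption
      · rw [sum_pair h12, card_pair h12]
        have := card_union_add_card_inter (N k₁) (N k₂)
        have e : ({k₁, k₂} : Finset κ).biUnion N = N k₁ ∪ N k₂ := by
          ext; simp
        rw [e]; omega
    | succ t ih =>
      intro ht
      obtain ⟨S, hSK, hSc, hk1, hS⟩ := ih (by omega)
      have hUne : (S.biUnion N).Nonempty := by
        obtain ⟨v, hv⟩ := hne k₁ h1
        exact ⟨v, mem_biUnion.2 ⟨k₁, hk1, hv⟩⟩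
      have : ∃ k ∈ K, k ∉ S ∧ (N k ∩ S.biUnion N).Nonempty := by
        by_cases hU : S.biUnion N = univ
        · obtain ⟨k, hk, hkS⟩ := exists_mem_notMem_of_card_lt_card (s := S) (t := K) (by omega)
          refine ⟨k, hk, hkS, ?_⟩
          rw [hU, inter_univ]
          exact hne k hk
        · obtain ⟨k, hk, hi, hn⟩ := hcross _ hUne hU
          exact ⟨k, hk, fun hkS => hn (subset_biUnion_of_mem N hkS), hi⟩
      obtain ⟨k, hk, hkS, hi⟩ := this
      refine ⟨insert k S, insert_subset hk hSK, ?_, mem_insert_of_mem hk1, ?_⟩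
      · rw [card_insert_of_notMem hkS]; omega
      · rw [card_insert_of_notMem hkS, sum_insert hkS, biUnion_insert]
        have := card_union_add_card_inter (N k) (S.biUnion N)
        have := hi.card_pos
        omega
  have hK2 : 2 ≤ K.card := by
    rw [← card_pair h12]
    apply card_le_card
    intro k hk
    simp only [mem_insert, mem_singleton] at hk
    rcases hk with rfl | rfl <;> assumption
  obtain ⟨S, hSK, hSc, hk1, hS⟩ := key (K.card - 2) (by omega)
  have hSe : S = K := eq_of_subset_of_card_le hSK (by omega)
  subst hSe
  have hU : S.biUnion N = univ := by
    by_contra hU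
    have hUne : (S.biUnion N).Nonempty := by
      obtain ⟨v, hv⟩ := hne k₁ h1
      exact ⟨v, mem_biUnion.2 ⟨k₁, hk1, hv⟩⟩
    obtain ⟨k, hk, hi, hn⟩ := hcross _ hUne hU
    exact hn (subset_biUnion_of_mem N hk)
  rw [hU, card_univ] at hS
  exact hS

lemma cover_edge_count {α κ : Type*} [DecidableEq α] [DecidableEq κ]
    (T : Finset α) (E : κ → Finset α) (K : Finset κ)
    (hcov : ∀ a ∈ T, ∃ k ∈ K, a ∈ E k)
    (a₀ : α) (k₁ k₂ : κ) (h1 : k₁ ∈ K) (h2 : k₂ ∈ K) (h12 : k₁ ≠ k₂)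
    (ha1 : a₀ ∈ E k₁) (ha2 : a₀ ∈ E k₂) :
    T.card + 1 ≤ ∑ k ∈ K, (E k).card := by
  have hsub : T ⊆ (E k₁).erase a₀ ∪ (K.erase k₁).biUnion E := by
    intro a ha
    simp only [mem_union, mem_erase, mem_biUnion]
    by_cases h : a = a₀
    · subst h
      exact Or.inr ⟨k₂, ⟨h12.symm, h2⟩, ha2⟩
    · obtain ⟨k, hk, hak⟩ := hcov a ha
      by_cases hkk : k = k₁
      · subst hkk; exact Or.inl ⟨h, hak⟩
      · exact Or.inr ⟨k, ⟨hkk, hk⟩, hak⟩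
  have c1 := card_le_card hsub
  have c2 := card_union_le ((E k₁).erase a₀) ((K.erase k₁).biUnion E)
  have c3 := card_biUnion_le (s := K.erase k₁) (t := E)
  have c4 := card_erase_add_one ha1
  have c5 := add_sum_erase K (fun k => (E k).card) h1
  omega

lemma crossing_edge {V : Type*} [Fintype V] [DecidableEq V] (R : SimpleGraph V)
    (hconn : R.Connected) (U : Finset V) (hU : U.Nonempty) (hU' : U ≠ univ) :
    ∃ a b, R.Adj a b ∧ a ∈ U ∧ b ∉ U := by
  obtain ⟨u, hu⟩ := hU
  have : ∃ w, w ∉ U := by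
    by_contra hcon
    push Not at hcon
    exact hU' (eq_univ_iff_forall.2 hcon)
  obtain ⟨w, hw⟩ := this
  obtain ⟨p⟩ := hconn.preconnected u w
  obtain ⟨d, -, hd1, hd2⟩ := p.exists_boundary_dart (U : Set V) (by simpa using hu) (by simpa using hw)
  exact ⟨d.fst, d.snd, d.adj, by simpa using hd1, by simpa using hd2⟩

lemma sum_pairs_pow_le {ι : Type*} [Fintype ι] [DecidableEq ι] (hι : 1 ≤ Fintype.card ι)
    (m : ℕ) (A : ℝ) (hA : 0 ≤ A) :
    ∑ p : (ι → Fin m) × (ι → Fin m), A ^ (univ.image p.1 ∪ univ.image p.2).card ≤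
      (Real.exp (A * m) - 1) * (2 * (Fintype.card ι : ℝ)) ^ (2 * Fintype.card ι) := by
  set s := Fintype.card ι with hs
  have hne : ∀ p : (ι → Fin m) × (ι → Fin m), univ.image p.1 ∪ univ.image p.2 ∈
      (univ : Finset (Finset (Fin m))).erase ∅ := by
    intro p
    obtain ⟨i⟩ : Nonempty ι := Fintype.card_pos_iff.1 hι
    refine mem_erase.2 ⟨?_, mem_univ _⟩
    exact nonempty_iff_ne_empty.1 ⟨p.1 i, by simp⟩
  rw [← sum_fiberwise_of_maps_to (t := (univ : Finset (Finset (Fin m))).erase ∅)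
    (g := fun p => univ.image p.1 ∪ univ.image p.2) (fun p _ => hne p)]
  have step : ∀ K ∈ (univ : Finset (Finset (Fin m))).erase ∅,
      ∑ p : (ι → Fin m) × (ι → Fin m) with univ.image p.1 ∪ univ.image p.2 = K,
        A ^ (univ.image p.1 ∪ univ.image p.2).card ≤ A ^ K.card * (2 * (s : ℝ)) ^ (2 * s) := by
    intro K _
    have e1 : ∑ p : (ι → Fin m) × (ι → Fin m) with univ.image p.1 ∪ univ.image p.2 = K,
        A ^ (univ.image p.1 ∪ univ.image p.2).card =
        ((univ.filter (fun p : (ι → Fin m) × (ι → Fin m) =>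
          univ.image p.1 ∪ univ.image p.2 = K)).card : ℝ) * A ^ K.card := by
      rw [← nsmul_eq_mul]
      apply sum_eq_card_nsmul
      intro p hp
      rw [(mem_filter.1 hp).2]
    rw [e1, mul_comm]
    apply mul_le_mul_of_nonneg_left _ (pow_nonneg hA _)
    have hcard : (univ.filter (fun p : (ι → Fin m) × (ι → Fin m) =>
          univ.image p.1 ∪ univ.image p.2 = K)).card ≤ (2 * s) ^ (2 * s) := by
      rcases (univ.filter (fun p : (ι → Fin m) × (ι → Fin m) =>
          univ.image p.1 ∪ univ.image p.2 = K)).eq_empty_or_nonempty with h0 | ⟨p, hp⟩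
      · rw [h0]; simp
      · have hK : K.card ≤ 2 * s := by
          rw [← (mem_filter.1 hp).2]
          have a1 := card_union_le (univ.image p.1) (univ.image p.2)
          have a2 := card_image_le (s := (univ : Finset ι)) (f := p.1)
          have a3 := card_image_le (s := (univ : Finset ι)) (f := p.2)
          rw [card_univ] at a2 a3
          omega
        calc _ ≤ (Fintype.piFinset (fun _ : ι => K) ×ˢ Fintype.piFinset (fun _ : ι => K)).card := by
              apply card_le_card
              intro q hq
              have hq := (mem_filter.1 hq).2
              rw [mem_product, Fintype.mem_piFinset, Fintype.mem_piFinset, ← hq]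
              constructor <;> intro i <;> simp
          _ = K.card ^ (2 * s) := by
              rw [card_product, Fintype.card_piFinset]
              simp only [prod_const, card_univ]
              rw [← hs, ← pow_add]; congr 1; ring
          _ ≤ _ := Nat.pow_le_pow_left hK _
    exact_mod_cast hcard
  refine (sum_le_sum step).trans ?_
  rw [← sum_mul]
  apply mul_le_mul_of_nonneg_right _ (by positivity)
  have e2 : ∑ K : Finset (Fin m), A ^ K.card = (A + 1) ^ m := by
    have := Finset.sum_pow_mul_eq_add_pow A 1 (univ : Finset (Fin m))
    simpa using this
  have e3 := add_sum_erase (univ : Finset (Finset (Fin m))) (fun K => A ^ K.card) (mem_univ ∅)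
  rw [e2] at e3
  simp only [card_empty, pow_zero] at e3
  have e4 : (A + 1) ^ m ≤ Real.exp (A * m) := by
    rw [mul_comm, Real.exp_nat_mul]
    exact pow_le_pow_left₀ (by linarith) (Real.add_one_le_exp A) _
  linarith

/-- Let `R` be a finite connected simple graph with `r = |V(R)| ≥ 2`
vertices and `s = |E(R)| ≥ 1` edges. Let `m, n ≥ 1` be integers, let `x, c` be positive
reals with `x ≤ n`, let `y ∈ (0,1]`, and let `h` assign to each nonempty subset
`E ⊆ E(R)` a nonnegative real with `h(E) ≤ r! · c · (x/n)^‖E‖ · y^|E|`. Then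
`Σ_{(φ,ψ): φ ≠ ψ} Π_{k ∈ Ran(φ) ∪ Ran(ψ)} h(φ⁻¹(k) ∪ ψ⁻¹(k))
  ≤ (e^{r!cxm/n} − 1) · (2s)^{2s} · x^r · y^{s+1} · n^{−r}`,
the sum over all ordered pairs of distinct functions `φ, ψ : E(R) → {1, …, m}`. -/
theorem sum_over_pairs_of_colourings_prod_le
    {V : Type*} [Fintype V] [DecidableEq V] (R : SimpleGraph V) [DecidableRel R.Adj]
    (hconn : R.Connected) (r s : ℕ)
    (hr : r = Fintype.card V) (hr2 : 2 ≤ r)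
    (hs : s = R.edgeFinset.card) (hs1 : 1 ≤ s)
    (m n : ℕ) (hm : 1 ≤ m) (hn : 1 ≤ n)
    (x y c : ℝ) (hx : 0 < x) (hy0 : 0 < y) (hy1 : y ≤ 1) (hc : 0 < c) (hxn : x ≤ (n : ℝ))
    (h : Finset (Sym2 V) → ℝ)
    (hnonneg : ∀ E ∈ R.edgeFinset.powerset, E.Nonempty → 0 ≤ h E)
    (hub : ∀ E ∈ R.edgeFinset.powerset, E.Nonempty →
      h E ≤ (r.factorial : ℝ) * c * (x / n) ^ (nodeCount E) * y ^ E.card) :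
    ∑ φ : {e // e ∈ R.edgeFinset} → Fin m, ∑ ψ : {e // e ∈ R.edgeFinset} → Fin m,
        (if φ ≠ ψ then
          ∏ k ∈ Finset.univ.image φ ∪ Finset.univ.image ψ,
            h (((R.edgeFinset.attach.filter (fun e => φ e = k)).image Subtype.val) ∪
               ((R.edgeFinset.attach.filter (fun e => ψ e = k)).image Subtype.val))
        else 0) ≤
      (Real.exp ((r.factorial : ℝ) * c * x * m / n) - 1) * (2 * (s : ℝ)) ^ (2 * s) *
        x ^ r * y ^ (s + 1) * (n : ℝ) ^ (-(r : ℤ)) := by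
  have hn0 : (0 : ℝ) < n := by exact_mod_cast hn
  set q : ℝ := x / n with hq
  have hq0 : 0 < q := div_pos hx hn0
  have hq1 : q ≤ 1 := (div_le_one hn0).2 hxn
  set C : ℝ := (r.factorial : ℝ) * c with hC
  have hC0 : 0 < C := by positivity
  have hterm : ∀ φ ψ : {e // e ∈ R.edgeFinset} → Fin m, (if φ ≠ ψ then
          ∏ k ∈ Finset.univ.image φ ∪ Finset.univ.image ψ,
            h (((R.edgeFinset.attach.filter (fun e => φ e = k)).image Subtype.val) ∪
               ((R.edgeFinset.attach.filter (fun e => ψ e = k)).image Subtype.val))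
        else 0) ≤ (C * q) ^ (univ.image φ ∪ univ.image ψ).card * (q ^ r * y ^ (s + 1)) := by
    intro φ ψ
    split_ifs with hne
    swap
    · positivity
    set F : Fin m → Finset (Sym2 V) := fun k =>
      ((R.edgeFinset.attach.filter (fun e => φ e = k)).image Subtype.val) ∪
               ((R.edgeFinset.attach.filter (fun e => ψ e = k)).image Subtype.val) with hF
    set K := univ.image φ ∪ univ.image ψ with hK
    have hφF : ∀ e, e.1 ∈ F (φ e) := by
      intro e
      refine mem_union_left _ (mem_image.2 ⟨e, ?_, rfl⟩)
      simp
    have hψF : ∀ e, e.1 ∈ F (ψ e) := by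
      intro e
      refine mem_union_right _ (mem_image.2 ⟨e, ?_, rfl⟩)
      simp
    have hφK : ∀ e, φ e ∈ K := fun e => mem_union_left _ (mem_image_of_mem _ (mem_univ _))
    have hψK : ∀ e, ψ e ∈ K := fun e => mem_union_right _ (mem_image_of_mem _ (mem_univ _))
    have hFsub : ∀ k, F k ∈ R.edgeFinset.powerset := by
      intro k
      rw [mem_powerset]
      intro e he
      rcases mem_union.1 he with he | he <;>
      · obtain ⟨a, -, rfl⟩ := mem_image.1 he
        exact a.2
    have hFne : ∀ k ∈ K, (F k).Nonempty := by
      intro k hk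
      rcases mem_union.1 hk with hk | hk
      · obtain ⟨e, -, rfl⟩ := mem_image.1 hk
        exact ⟨_, hφF e⟩
      · obtain ⟨e, -, rfl⟩ := mem_image.1 hk
        exact ⟨_, hψF e⟩
    obtain ⟨e₀, he₀⟩ := Function.ne_iff.1 hne
    have hE : s + 1 ≤ ∑ k ∈ K, (F k).card := by
      rw [hs]
      exact cover_edge_count R.edgeFinset F K (fun a ha => ⟨φ ⟨a, ha⟩, hφK _, hφF ⟨a, ha⟩⟩)
        e₀.1 (φ e₀) (ψ e₀) (hφK _) (hψK _) he₀ (hφF _) (hψF _)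
    have hN : r + K.card ≤ ∑ k ∈ K, nodeCount (F k) := by
      rw [hr]
      refine cover_node_count (fun k => univ.filter (fun v => ∃ e ∈ F k, v ∈ e)) K ?_ ?_
        (φ e₀) (ψ e₀) (hφK _) (hψK _) he₀ ?_
      · intro U hU hU'
        obtain ⟨a, b, hab, ha, hb⟩ := crossing_edge R hconn U hU hU'
        have hmem : s(a, b) ∈ R.edgeFinset := by simpa using hab
        have hm' := hφF ⟨s(a, b), hmem⟩
        refine ⟨φ ⟨s(a, b), hmem⟩, hφK _, ⟨a, ?_⟩, fun hsub => hb (hsub ?_)⟩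
        · exact mem_inter.2 ⟨mem_filter.2 ⟨mem_univ _, _, hm', Sym2.mem_mk_left a b⟩, ha⟩
        · exact mem_filter.2 ⟨mem_univ _, _, hm', Sym2.mem_mk_right a b⟩
      · intro k hk
        obtain ⟨e, he⟩ := hFne k hk
        induction e using Sym2.ind with
        | _ a b => exact ⟨a, mem_filter.2 ⟨mem_univ _, _, he, Sym2.mem_mk_left a b⟩⟩
      · have h1 := hφF e₀
        have h2 := hψF e₀
        have h3 := e₀.2
        generalize e₀.1 = e at h1 h2 h3
        generalize φ e₀ = k1 at *
        generalize ψ e₀ = k2 at *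
        induction e using Sym2.ind with
        | _ a b =>
          have hab : a ≠ b := by
            have : R.Adj a b := by simpa using h3
            exact this.ne
          rw [← card_pair hab]
          apply card_le_card
          intro v hv
          have hv' : v ∈ s(a, b) := by simpa using hv
          exact mem_inter.2 ⟨mem_filter.2 ⟨mem_univ _, _, h1, hv'⟩,
            mem_filter.2 ⟨mem_univ _, _, h2, hv'⟩⟩
    calc ∏ k ∈ K, h (F k) ≤ ∏ k ∈ K, (C * q ^ (nodeCount (F k)) * y ^ (F k).card) :=
          prod_le_prod (fun k hk => hnonneg _ (hFsub k) (hFne k hk))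
            (fun k hk => hub _ (hFsub k) (hFne k hk))
      _ = C ^ K.card * q ^ (∑ k ∈ K, nodeCount (F k)) * y ^ (∑ k ∈ K, (F k).card) := by
          rw [prod_mul_distrib, prod_mul_distrib, prod_const, prod_pow_eq_pow_sum,
            prod_pow_eq_pow_sum]
      _ ≤ C ^ K.card * q ^ (r + K.card) * y ^ (s + 1) := by
          have b1 := pow_le_pow_of_le_one hq0.le hq1 hN
          have b2 := pow_le_pow_of_le_one hy0.le hy1 hE
          gcongr ?_ * ?_ * ?_
      _ = _ := by rw [mul_pow, pow_add]; ring
  refine (sum_le_sum fun φ _ => sum_le_sum fun ψ _ => hterm φ ψ).trans ?_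
  have hcard : Fintype.card {e // e ∈ R.edgeFinset} = s := by rw [Fintype.card_coe, hs]
  have hmain := sum_pairs_pow_le (ι := {e // e ∈ R.edgeFinset}) (by rw [hcard]; exact hs1) m
    (C * q) (by positivity)
  rw [hcard, Fintype.sum_prod_type] at hmain
  simp only [← sum_mul]
  refine (mul_le_mul_of_nonneg_right hmain (by positivity)).trans (le_of_eq ?_)
  have e1 : C * q * m = C * x * m / n := by rw [hq]; ring
  rw [e1, hq, div_pow, zpow_neg, zpow_natCast]
  ring
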